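/- Every nontrivial graph property on 4 vertices is evasive: if P is a set of simple graphs on 4 vertices, closed under isomorphism, with P ≠ ∅ and P ≠ univ, then every edge-query decision tree computing the indicator function of P has depth at least 6 = C(4,2). -/

import Mathlib

/-- An edge-query decision tree on `n` vertices: either a leaf labeled with a
Boolean, or an internal node labeled with a pair of distinct vertices together
with two subtrees. -/
inductive EdgeTree (n : ℕ) : Type where
  | leaf (b : Bool) : EdgeTree n
  | node (u v : Fin n) (huv : u ≠ v) (tYes tNo : EdgeTree n) : EdgeTree n

open Classical in
/-- Evaluate a decision tree on a graph `G`: at each internal node, branch to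
the first subtree if the queried pair is an edge of `G` and to the second
subtree otherwise; return the Boolean at the leaf reached. -/
noncomputable def EdgeTree.eval {n : ℕ} : EdgeTree n → SimpleGraph (Fin n) → Bool
  | .leaf b, _ => b
  | .node u v _ tYes tNo, G => if G.Adj u v then tYes.eval G else tNo.eval G

/-- The depth of a decision tree: the maximal number of internal nodes on a
root-to-leaf path. -/
def EdgeTree.depth {n : ℕ} : EdgeTree n → ℕ
  | .leaf _ => 0
  | .node _ _ _ tYes tNo => 1 + max tYes.depth tNo.depth

/-- A decision tree computes (the indicator function of) a set `P` of graphs if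
it evaluates to `true` on `G` exactly when `G ∈ P`. -/
def EdgeTree.Computes {n : ℕ} (t : EdgeTree n) (P : Set (SimpleGraph (Fin n))) : Prop :=
  ∀ G : SimpleGraph (Fin n), t.eval G = true ↔ G ∈ P

/-- A set of graphs is closed under isomorphism. -/
def IsoClosed {n : ℕ} (P : Set (SimpleGraph (Fin n))) : Prop :=
  ∀ G H : SimpleGraph (Fin n), Nonempty (G ≃g H) → G ∈ P → H ∈ P

/-! ### Boolean functions on subcubes

A Boolean function of finitely many bits is a function `f : ℕ → Bool` of bit masks. The subcube
with free coordinates `L` and base point `v` consists of the masks agreeing with `v` outside `L`. -/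

/-- The signed count of the points of the subcube `(L, v)` at which `f` is true. -/
def alternatingCount (f : ℕ → Bool) : List ℕ → ℕ → ℤ
  | [], v => (f v).toNat
  | i :: L, v => alternatingCount f L v - alternatingCount f L (v ||| 2 ^ i)

/-- For `L.length = n + 1`: whether `f` on the subcube `(L, v)` can be computed by querying at
most `n` coordinates. The test of the alternating count is redundant, but speeds up evaluation. -/
def isNonevasive (f : ℕ → Bool) : ℕ → List ℕ → ℕ → Bool
  | 0, L, v => L.any fun i => f v == f (v ||| 2 ^ i)
  | n + 1, L, v => decide (alternatingCount f L v = 0) && L.any fun i =>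
      isNonevasive f n (L.erase i) v && isNonevasive f n (L.erase i) (v ||| 2 ^ i)

theorem alternatingCount_perm (f : ℕ → Bool) {L M : List ℕ} (h : L.Perm M) (v : ℕ) :
    alternatingCount f L v = alternatingCount f M v := by
  induction h generalizing v with
  | nil => rfl
  | cons i _ ih => simp only [alternatingCount, ih]
  | swap i j L =>
    simp only [alternatingCount, Nat.lor_assoc, Nat.lor_comm (2 ^ i) (2 ^ j)]
    ring
  | trans _ _ ih₁ ih₂ => rw [ih₁, ih₂]

theorem testBit_or_two_pow (v i j : ℕ) :
    (v ||| 2 ^ i).testBit j = (v.testBit j || decide (i = j)) := by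
  rw [Nat.testBit_or, Nat.testBit_two_pow]

theorem alternatingCount_of_const (f : ℕ → Bool) (b : Bool) (L : List ℕ) (v : ℕ)
    (h : ∀ w, (∀ i, i ∉ L → w.testBit i = v.testBit i) → f w = b) :
    alternatingCount f L v = if L = [] ∧ b then 1 else 0 := by
  induction L generalizing v with
  | nil => cases b <;> simp [alternatingCount, h v fun _ _ => rfl]
  | cons i L ih =>
    have h₀ := ih v fun w hw => h w fun j hj => hw j fun hj' => hj (List.mem_cons_of_mem _ hj')
    have h₁ := ih (v ||| 2 ^ i) fun w hw => h w fun j hj => by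
      rw [List.mem_cons, not_or] at hj
      rw [hw j hj.2, testBit_or_two_pow]
      simp [Ne.symm hj.1]
    simp [alternatingCount, h₀, h₁]

theorem isNonevasive_of_const (f : ℕ → Bool) (b : Bool) (n : ℕ) (L : List ℕ) (v : ℕ)
    (hL : L.length = n + 1)
    (h : ∀ w, (∀ i, i ∉ L → w.testBit i = v.testBit i) → f w = b) :
    isNonevasive f n L v = true := by
  induction n generalizing L v with
  | zero =>
    obtain ⟨i, rfl⟩ := List.length_eq_one_iff.1 hL
    have h₁ : f (v ||| 2 ^ i) = b := h _ fun j hj => by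
      rw [List.mem_singleton] at hj
      simp [Ne.symm hj]
    simp [isNonevasive, h v fun _ _ => rfl, h₁]
  | succ n ih =>
    obtain ⟨i, L, rfl⟩ := List.exists_cons_of_length_eq_add_one hL
    have h₀ := ih L v (by simpa using hL) fun w hw =>
      h w fun j hj => hw j fun hj' => hj (List.mem_cons_of_mem _ hj')
    have h₁ := ih L (v ||| 2 ^ i) (by simpa using hL) fun w hw => h w fun j hj => by
      rw [List.mem_cons, not_or] at hj
      rw [hw j hj.2, testBit_or_two_pow]
      simp [Ne.symm hj.1]
    have hc := alternatingCount_of_const f b (i :: L) v h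
    simp only [isNonevasive, Bool.and_eq_true, decide_eq_true_eq, List.any_eq_true]
    exact ⟨by simpa using hc, i, by simp, by simpa using h₀, by simpa using h₁⟩

theorem alternatingCount_eq_zero (f : ℕ → Bool) (n : ℕ) (L : List ℕ) (v : ℕ)
    (hL : L.length = n + 1) (h : isNonevasive f n L v = true) :
    alternatingCount f L v = 0 := by
  cases n with
  | zero =>
    obtain ⟨i, rfl⟩ := List.length_eq_one_iff.1 hL
    have h' : f v = f (v ||| 2 ^ i) := by simpa [isNonevasive] using h
    simp [alternatingCount, h']
  | succ n =>
    simp only [isNonevasive, Bool.and_eq_true, decide_eq_true_eq] at h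
    exact h.1

theorem isNonevasive_succ (f : ℕ → Bool) (n : ℕ) (L : List ℕ) (v i : ℕ) (hi : i ∈ L)
    (hL : L.length = n + 2) (h₀ : isNonevasive f n (L.erase i) v = true)
    (h₁ : isNonevasive f n (L.erase i) (v ||| 2 ^ i) = true) :
    isNonevasive f (n + 1) L v = true := by
  have hlen : (L.erase i).length = n + 1 := by rw [List.length_erase_of_mem hi, hL]; rfl
  simp only [isNonevasive, Bool.and_eq_true, decide_eq_true_eq, List.any_eq_true]
  refine ⟨?_, i, hi, h₀, h₁⟩
  rw [alternatingCount_perm f (List.perm_cons_erase hi), alternatingCount,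
    alternatingCount_eq_zero f n _ _ hlen h₀, alternatingCount_eq_zero f n _ _ hlen h₁, sub_zero]

/-! ### Graphs on four vertices as bit masks -/

/-- The index in `0, …, 5` of an unordered pair of distinct vertices. -/
def edgeIndex (u v : Fin 4) : ℕ :=
  if min u v = 0 then (max u v : Fin 4).val - 1 else u.val + v.val

/-- The graph whose edges are the pairs with index in the bit mask `m`. -/
def graphOfMask (m : ℕ) : SimpleGraph (Fin 4) where
  Adj u v := u ≠ v ∧ m.testBit (edgeIndex u v) = true
  symm := ⟨fun u v h => ⟨h.1.symm, by
    have : edgeIndex v u = edgeIndex u v := by simp only [edgeIndex, min_comm, max_comm, add_comm]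
    rw [this]; exact h.2⟩⟩
  loopless := ⟨fun _ h => h.1 rfl⟩

theorem exists_graphOfMask_eq (G : SimpleGraph (Fin 4)) : ∃ m < 64, graphOfMask m = G := by
  classical
  let e : Fin 6 → Fin 4 × Fin 4 := ![(0, 1), (0, 2), (0, 3), (1, 2), (1, 3), (2, 3)]
  let b : Fin 6 → Bool := fun k => decide (G.Adj (e k).1 (e k).2)
  refine ⟨Nat.ofBits b, Nat.ofBits_lt_two_pow b, ?_⟩
  have key : ∀ u v : Fin 4, u ≠ v →
      ∃ k : Fin 6, edgeIndex u v = k ∧ (e k = (u, v) ∨ e k = (v, u)) := by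
    decide
  ext u v
  change u ≠ v ∧ _ ↔ _
  constructor
  · rintro ⟨huv, h⟩
    obtain ⟨k, hk, hek⟩ := key u v huv
    rw [hk, Nat.testBit_ofBits_lt b k k.2] at h
    have h' : G.Adj (e k).1 (e k).2 := by simpa [b] using h
    rcases hek with hek | hek <;> rw [hek] at h'
    exacts [h', h'.symm]
  · intro h
    obtain ⟨k, hk, hek⟩ := key u v h.ne
    refine ⟨h.ne, ?_⟩
    rw [hk, Nat.testBit_ofBits_lt b k k.2]
    have h' : G.Adj (e k).1 (e k).2 := by
      rcases hek with hek | hek <;> rw [hek]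
      exacts [h, h.symm]
    simpa [b] using h'

theorem isNonevasive_of_depth_le (f : ℕ → Bool) (t : EdgeTree 4) (n : ℕ) (L : List ℕ) (v : ℕ)
    (hL : L.length = n + 1) (hnd : L.Nodup) (hv : ∀ i ∈ L, v.testBit i = false)
    (hd : t.depth ≤ n)
    (h : ∀ w, (∀ i, i ∉ L → w.testBit i = v.testBit i) → f w = t.eval (graphOfMask w)) :
    isNonevasive f n L v = true := by
  induction t generalizing n L v with
  | leaf b => exact isNonevasive_of_const f b n L v hL h
  | node x y hxy t₁ t₀ ih₁ ih₀ =>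
    simp only [EdgeTree.depth] at hd
    have heval : ∀ w, (EdgeTree.node x y hxy t₁ t₀).eval (graphOfMask w) =
        if w.testBit (edgeIndex x y) = true then t₁.eval (graphOfMask w)
        else t₀.eval (graphOfMask w) := fun w => by
      have : (graphOfMask w).Adj x y ↔ w.testBit (edgeIndex x y) = true := and_iff_right hxy
      simp only [EdgeTree.eval, this]
    simp only [heval] at h
    generalize edgeIndex x y = i at h
    by_cases hi : i ∈ L
    · obtain ⟨n, rfl⟩ : ∃ k, n = k + 1 := ⟨n - 1, by omega⟩
      have hlen : (L.erase i).length = n + 1 := by rw [List.length_erase_of_mem hi, hL]; rfl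
      have hout : ∀ j, j ∉ L → j ∉ L.erase i ∧ i ≠ j := fun j hj =>
        ⟨fun h' => hj (List.mem_of_mem_erase h'), fun h' => hj (h' ▸ hi)⟩
      have hni : i ∉ L.erase i := hnd.not_mem_erase
      refine isNonevasive_succ f n L v i hi hL
        (ih₀ n _ _ hlen (hnd.erase i) (fun j hj => hv j (List.mem_of_mem_erase hj)) (by omega)
          fun w hw => ?_)
        (ih₁ n _ _ hlen (hnd.erase i) (fun j hj => ?_) (by omega) fun w hw => ?_)
      · rw [h w fun j hj => hw j (hout j hj).1, if_neg]
        rw [hw i hni, hv i hi]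
        simp
      · have hij : i ≠ j := fun h' => hni (h' ▸ hj)
        simp [hv j (List.mem_of_mem_erase hj), hij]
      · rw [h w fun j hj => ?_, if_pos]
        · rw [hw i hni, testBit_or_two_pow]
          simp
        · rw [hw j (hout j hj).1, testBit_or_two_pow]
          simp [(hout j hj).2]
    · cases hb : v.testBit i with
      | true =>
        exact ih₁ n L v hL hnd hv (by omega) fun w hw => by
          rw [h w hw, if_pos (by rw [hw i hi, hb])]
      | false =>
        exact ih₀ n L v hL hnd hv (by omega) fun w hw => by
          rw [h w hw, if_neg (by rw [hw i hi, hb]; simp)]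

/-! ### Isomorphism classes -/

/-- The number in `0, …, 10` of the isomorphism class of `graphOfMask m`, for `m < 64`. -/
def isoClass (m : ℕ) : ℕ :=
  76708710651315772723299357979666198027146880747338764030584975497693080133904 >>> (4 * m) % 16

/-- Representatives of the eleven isomorphism classes of graphs on four vertices. -/
def isoRep : List ℕ := [0, 1, 3, 12, 7, 11, 13, 15, 30, 31, 63]

theorem exists_iso_isoRep : ∀ m < 64, isoClass m < 11 ∧ ∃ σ : Equiv.Perm (Fin 4), ∀ u v : Fin 4,
    (σ u ≠ σ v ∧ m.testBit (edgeIndex (σ u) (σ v)) = true) ↔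
      (u ≠ v ∧ (isoRep.getD (isoClass m) 0).testBit (edgeIndex u v) = true) := by
  decide +kernel

/-- The number of graphs with an even number of edges in the union of the isomorphism classes
selected by the bits of `c`. -/
def evenCount (c : ℕ) : ℕ :=
  (c.testBit 0).toNat + 12 * (c.testBit 2).toNat + 3 * (c.testBit 3).toNat +
    12 * (c.testBit 7).toNat + 3 * (c.testBit 8).toNat + (c.testBit 10).toNat

/-- The number of graphs with an odd number of edges in the union of the isomorphism classes
selected by the bits of `c`. -/
def oddCount (c : ℕ) : ℕ :=
  6 * (c.testBit 1).toNat + 4 * (c.testBit 4).toNat + 4 * (c.testBit 5).toNat +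
    12 * (c.testBit 6).toNat + 6 * (c.testBit 9).toNat

theorem alternatingCount_isoClass (c : ℕ) :
    alternatingCount (fun m => c.testBit (isoClass m)) [0, 1, 2, 3, 4, 5] 0 =
      evenCount c - oddCount c := by
  simp only [alternatingCount, evenCount, oddCount, isoClass, Nat.reduceMul, Nat.reducePow,
    Nat.reduceOr, Nat.reduceShiftRight, Nat.reduceMod]
  push_cast
  ring

theorem isNonevasive_isoClass_eq_false_of_count_eq : ∀ a < 32, ∀ b < 64,
    evenCount (64 * a + b) = oddCount (64 * a + b) → 64 * a + b ≠ 0 → 64 * a + b ≠ 2047 →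
      isNonevasive (fun m => (64 * a + b).testBit (isoClass m)) 5 [0, 1, 2, 3, 4, 5] 0 = false := by
  decide +kernel

theorem isNonevasive_isoClass_eq_false (c : ℕ) (hc : c < 2048) (hc₀ : c ≠ 0) (hc₁ : c ≠ 2047) :
    isNonevasive (fun m => c.testBit (isoClass m)) 5 [0, 1, 2, 3, 4, 5] 0 = false := by
  by_cases h : evenCount c = oddCount c
  · have := isNonevasive_isoClass_eq_false_of_count_eq (c / 64) (by omega) (c % 64) (by omega)
    rw [Nat.div_add_mod] at this
    exact this h hc₀ hc₁
  · refine Bool.eq_false_iff.2 fun h' => h ?_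
    have := alternatingCount_eq_zero _ 5 _ _ rfl h'
    rw [alternatingCount_isoClass] at this
    omega

/-- Every nontrivial graph property on 4 vertices is evasive: every decision
tree computing it has depth at least 6 = C(4,2). -/
theorem four_vertices_evasive (P : Set (SimpleGraph (Fin 4)))
    (hiso : IsoClosed P) (hne : P ≠ ∅) (hnu : P ≠ Set.univ)
    (t : EdgeTree 4) (ht : t.Computes P) : 6 ≤ t.depth := by
  classical
  by_contra! hd
  have hinv : ∀ m < 64, graphOfMask m ∈ P ↔ graphOfMask (isoRep.getD (isoClass m) 0) ∈ P := by
    intro m hm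
    obtain ⟨-, σ, hσ⟩ := exists_iso_isoRep m hm
    let e : graphOfMask (isoRep.getD (isoClass m) 0) ≃g graphOfMask m :=
      ⟨σ, fun {u v} => hσ u v⟩
    exact ⟨hiso _ _ ⟨e.symm⟩, hiso _ _ ⟨e⟩⟩
  let b : Fin 11 → Bool := fun j => decide (graphOfMask (isoRep.getD j 0) ∈ P)
  have hc : ∀ m < 64, (Nat.ofBits b).testBit (isoClass m) = decide (graphOfMask m ∈ P) := by
    intro m hm
    rw [Nat.testBit_ofBits_lt b _ (exists_iso_isoRep m hm).1]
    simp only [b, hinv m hm]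
  have hlt : Nat.ofBits b < 2 ^ 11 := Nat.ofBits_lt_two_pow b
  generalize Nat.ofBits b = c at hc hlt
  obtain ⟨G, hG⟩ := Set.nonempty_iff_ne_empty.2 hne
  obtain ⟨m, hm, rfl⟩ := exists_graphOfMask_eq G
  obtain ⟨H, hH⟩ := (Set.ne_univ_iff_exists_notMem P).1 hnu
  obtain ⟨k, hk, rfl⟩ := exists_graphOfMask_eq H
  have hc₀ : c ≠ 0 := by
    rintro rfl
    simpa [hG] using hc m hm
  have hc₁ : c ≠ 2047 := by
    rintro rfl
    have := hc k hk
    rw [show 2047 = 2 ^ 11 - 1 from rfl, Nat.testBit_two_pow_sub_one] at this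
    simp [hH, (exists_iso_isoRep k hk).1] at this
  refine absurd (isNonevasive_of_depth_le _ t 5 [0, 1, 2, 3, 4, 5] 0 rfl (by decide) (by simp)
    (by omega) fun w hw => ?_)
    (Bool.eq_false_iff.1 (isNonevasive_isoClass_eq_false c hlt hc₀ hc₁))
  have hw_lt : w < 2 ^ 6 := Nat.lt_pow_two_of_testBit w fun i hi => by
    rw [hw i (by simp; omega), Nat.zero_testBit]
  rw [hc w hw_lt, Bool.eq_iff_iff, decide_eq_true_eq, ht]
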